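/- For every sequent Γ, the poset (oPLL∞(Γ), ⪯) of open coderivations with conclusion Γ under the approximation order is a Scott domain (a bounded-complete algebraic directed-complete partial order): its least element is the open derivation consisting of the single rule hyp with conclusion Γ; its maximal elements are exactly the hyp-free coderivations in PLL∞ with conclusion Γ; and its compact elements are exactly the open derivations (finite open coderivations) in oPLL∞(Γ). -/

import Mathlib

namespace NWPLL

/-! ## Formulas and sequents -/

inductive Formula : Type where
  | var : ℕ → Formula
  | covar : ℕ → Formula
  | tens : Formula → Formula → Formula
  | parr : Formula → Formula → Formula
  | bang : Formula → Formula
  | quest : Formula → Formula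
  | one : Formula
  | bot : Formula
deriving DecidableEq

/-- Linear negation, defined by De Morgan duality. -/
def Formula.neg : Formula → Formula
  | .var n => .covar n
  | .covar n => .var n
  | .tens A B => .parr A.neg B.neg
  | .parr A B => .tens A.neg B.neg
  | .bang A => .quest A.neg
  | .quest A => .bang A.neg
  | .one => .bot
  | .bot => .one

/-- A sequent is a finite list of formula occurrences. -/
abbrev Sequent := List Formula

/-! ## Rules -/

inductive RuleName : Type where
  | ax | cut | tens | parr | one | bot | qw | qb | cp | fp | hyp | dig
deriving DecidableEq

/-- Canonical instances of the rules (principal formulas at the head,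
conclusion of a rule together with the list of its premises, in order). -/
inductive Canon : RuleName → Sequent → List Sequent → Prop where
  | ax (A : Formula) : Canon .ax [A, A.neg] []
  | cut (A : Formula) (Γ Δ : Sequent) : Canon .cut (Γ ++ Δ) [A :: Γ, A.neg :: Δ]
  | tens (A B : Formula) (Γ Δ : Sequent) :
      Canon .tens (A.tens B :: (Γ ++ Δ)) [A :: Γ, B :: Δ]
  | parr (A B : Formula) (Γ : Sequent) : Canon .parr (A.parr B :: Γ) [A :: B :: Γ]
  | one : Canon .one [.one] []
  | bot (Γ : Sequent) : Canon .bot (.bot :: Γ) [Γ]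
  | qw (A : Formula) (Γ : Sequent) : Canon .qw (A.quest :: Γ) [Γ]
  | qb (A : Formula) (Γ : Sequent) : Canon .qb (A.quest :: Γ) [A :: A.quest :: Γ]
  | cp (A : Formula) (Γ : Sequent) :
      Canon .cp (A.bang :: Γ.map .quest) [A :: Γ, A.bang :: Γ.map .quest]
  | fp (A : Formula) (Γ : Sequent) : Canon .fp (A.bang :: Γ.map .quest) [A :: Γ]
  | hyp (Γ : Sequent) : Canon .hyp Γ []
  | dig (A : Formula) (Γ : Sequent) : Canon .dig (A.quest :: Γ) [A.quest.quest :: Γ]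

/-- A rule instance: a canonical instance up to permutation of each sequent
(sequents are lists of occurrences, managed up to exchange). -/
def RuleOk (r : RuleName) (C : Sequent) (ps : List Sequent) : Prop :=
  ∃ C₀ ps₀, Canon r C₀ ps₀ ∧ C.Perm C₀ ∧ List.Forall₂ List.Perm ps ps₀

/-! ## Coderivations -/

/-- Nodes of a binary tree: `false` = first (left) child, `true` = second (right) child. -/
abbrev Node := List Bool

/-- A (possibly non-wellfounded) coderivation skeleton: a labelling of an
ordered-prefix-closed binary tree by pairs (rule name, sequent). -/
structure Coderivation : Type where
  label : Node → Option (RuleName × Sequent)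
  root_isSome : (label []).isSome
  prefix_closed : ∀ v b, (label (v ++ [b])).isSome → (label v).isSome
  ordered : ∀ v, (label (v ++ [true])).isSome → (label (v ++ [false])).isSome

namespace Coderivation

def mem (D : Coderivation) (v : Node) : Prop := (D.label v).isSome

def ruleAt (D : Coderivation) (v : Node) : Option RuleName := (D.label v).map Prod.fst

def seqAt (D : Coderivation) (v : Node) : Option Sequent := (D.label v).map Prod.snd

def conclusion (D : Coderivation) : Sequent := ((D.label []).map Prod.snd).getD []

/-- The list of premises (sequents of the children) of the rule at node `v`. -/
def premsAt (D : Coderivation) (v : Node) : List Sequent :=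
  (D.seqAt (v ++ [false])).toList ++ (D.seqAt (v ++ [true])).toList

/-- `D` is a coderivation over the set of rules `S`: each node is a valid
instance of a rule of `S`. -/
def IsOver (D : Coderivation) (S : Set RuleName) : Prop :=
  ∀ v r Γ, D.label v = some (r, Γ) → r ∈ S ∧ RuleOk r Γ (D.premsAt v)

def IsFinite (D : Coderivation) : Prop := {v : Node | D.mem v}.Finite

end Coderivation

/-! ## Systems -/

def pllRules : Set RuleName := {.ax, .cut, .tens, .parr, .one, .bot, .qw, .qb, .fp}
def pllInfRules : Set RuleName := {.ax, .cut, .tens, .parr, .one, .bot, .qw, .qb, .cp}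
def oPllInfRules : Set RuleName := insert .hyp pllInfRules
def mellInfRules : Set RuleName := insert .dig pllInfRules

/-- Coderivations of `PLL∞`. -/
def PLLinf (D : Coderivation) : Prop := D.IsOver pllInfRules
/-- Open coderivations (`oPLL∞`). -/
def OPLLinf (D : Coderivation) : Prop := D.IsOver oPllInfRules
/-- Coderivations of `MELL∞` (with digging). -/
def MELLinf (D : Coderivation) : Prop := D.IsOver mellInfRules
/-- Finite derivations of the sequent calculus `PLL` (with functorial promotion). -/
def IsPLLDer (D : Coderivation) : Prop := D.IsOver pllRules ∧ D.IsFinite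

/-! ## Branches and global conditions -/

/-- The node at depth `n` along the infinite branch determined by the
direction function `β`. -/
def brNode (β : ℕ → Bool) (n : ℕ) : Node := (List.range n).map β

def InfBranch (D : Coderivation) (β : ℕ → Bool) : Prop := ∀ n, D.mem (brNode β n)

/-- Weak progressing: every infinite branch goes through the right premise of
a `c!p` rule infinitely often. -/
def WeaklyProg (D : Coderivation) : Prop :=
  ∀ β, InfBranch D β →
    ∀ N, ∃ n, N ≤ n ∧ β n = true ∧ D.ruleAt (brNode β n) = some .cp

/-- Position of the parent (in canonical instances): `childParent r k b p` is
the position in the conclusion of which the formula at position `p` of premise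
`b` is the parent; `k` is the length of the first premise. -/
def childParent : RuleName → ℕ → Bool → ℕ → Option ℕ
  | .cut, _, false, p => if p = 0 then none else some (p - 1)
  | .cut, k, true, p => if p = 0 then none else some (k - 1 + (p - 1))
  | .tens, _, false, p => if p = 0 then some 0 else some p
  | .tens, k, true, p => if p = 0 then some 0 else some (k + (p - 1))
  | .parr, _, false, p => if p ≤ 1 then some 0 else some (p - 1)
  | .bot, _, false, p => some (p + 1)
  | .qw, _, false, p => some (p + 1)
  | .qb, _, false, p => if p = 0 then none else some (p - 1)
  | .cp, _, false, _ => none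
  | .cp, _, true, p => some p
  | .fp, _, false, p => some p
  | .dig, _, false, p => some p
  | _, _, _, _ => none

/-- A position-preserving alignment between a sequent and (a permutation of
it given by) a canonical sequent. -/
def PosAlign (l l' : List Formula) (f : ℕ → ℕ) : Prop :=
  l.length = l'.length ∧
  (∀ i, i < l.length → f i < l'.length ∧ l'[f i]? = l[i]?) ∧
  (∀ i j, i < l.length → j < l.length → f i = f j → i = j)

def bIdx : Bool → ℕ
  | false => 0
  | true => 1

/-- The formula occurrence at position `p` of the premise `b` of the rule at
node `v` is the parent of the occurrence at position `q` of its conclusion. -/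
def IsParent (D : Coderivation) (v : Node) (b : Bool) (p q : ℕ) : Prop :=
  ∃ r C P C₀ P₀ ps₀, ∃ f g : ℕ → ℕ,
    D.label v = some (r, C) ∧ D.seqAt (v ++ [b]) = some P ∧
    Canon r C₀ ps₀ ∧ PosAlign C C₀ f ∧ ps₀[bIdx b]? = some P₀ ∧ PosAlign P P₀ g ∧
    childParent r (ps₀.headD []).length b (g p) = some (f q)

/-- The occurrence at position `q` of the conclusion of the rule at `v` is the
principal `!`-formula of a `c!p` rule. -/
def PrincipalCp (D : Coderivation) (v : Node) (q : ℕ) : Prop :=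
  ∃ C C₀ ps₀ f, D.label v = some (.cp, C) ∧ Canon .cp C₀ ps₀ ∧ PosAlign C C₀ f ∧ f q = 0

def Coderivation.formulaAt (D : Coderivation) (v : Node) (q : ℕ) : Option Formula :=
  (D.seqAt v).bind fun Γ => Γ[q]?

/-- The infinite branch `β` carries a progressing `!`-thread: from some point
on, a sequence of parent-linked `!`-formula occurrences which is infinitely
often principal for a `c!p` rule. -/
def ProgThread (D : Coderivation) (β : ℕ → Bool) : Prop :=
  ∃ k, ∃ t : ℕ → ℕ,
    (∀ i, k ≤ i → ∃ A, D.formulaAt (brNode β i) (t i) = some (Formula.bang A)) ∧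
    (∀ i, k ≤ i → IsParent D (brNode β i) (β i) (t (i + 1)) (t i)) ∧
    (∀ N, ∃ i, N ≤ i ∧ k ≤ i ∧ PrincipalCp D (brNode β i) (t i))

/-- Progressing criterion: every infinite branch carries a progressing `!`-thread. -/
def Progressing (D : Coderivation) : Prop := ∀ β, InfBranch D β → ProgThread D β

/-! ## Basic constructors on coderivations -/

def node0 (r : RuleName) (Γ : Sequent) : Coderivation where
  label w := match w with
    | [] => some (r, Γ)
    | _ :: _ => none
  root_isSome := rfl
  prefix_closed := by
    intro v b h
    match v with
    | [] => exact rfl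
    | c :: v' => exact Bool.noConfusion h
  ordered := by
    intro v h
    match v with
    | [] => exact Bool.noConfusion h
    | c :: v' => exact Bool.noConfusion h

def node1 (r : RuleName) (Γ : Sequent) (D : Coderivation) : Coderivation where
  label w := match w with
    | [] => some (r, Γ)
    | false :: w' => D.label w'
    | true :: _ => none
  root_isSome := rfl
  prefix_closed := by
    intro v b h
    match v with
    | [] => exact rfl
    | false :: v' => exact D.prefix_closed v' b h
    | true :: v' => exact Bool.noConfusion h
  ordered := by
    intro v h
    match v with
    | [] => exact Bool.noConfusion h
    | false :: v' => exact D.ordered v' h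
    | true :: v' => exact Bool.noConfusion h

def node2 (r : RuleName) (Γ : Sequent) (D E : Coderivation) : Coderivation where
  label w := match w with
    | [] => some (r, Γ)
    | false :: w' => D.label w'
    | true :: w' => E.label w'
  root_isSome := rfl
  prefix_closed := by
    intro v b h
    match v with
    | [] => exact rfl
    | false :: v' => exact D.prefix_closed v' b h
    | true :: v' => exact E.prefix_closed v' b h
  ordered := by
    intro v h
    match v with
    | [] => exact D.root_isSome
    | false :: v' => exact D.ordered v' h
    | true :: v' => exact E.ordered v' h

/-- The single-node `hyp` open derivation with conclusion `Γ`. -/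
def hypC (Γ : Sequent) : Coderivation := node0 .hyp Γ

/-- The sub-coderivation of `D` rooted at `v` (a default if `v` is not a node of `D`). -/
def Coderivation.subAt (D : Coderivation) (v : Node) : Coderivation :=
  if h : (D.label v).isSome then
    { label := fun w => D.label (v ++ w)
      root_isSome := by simpa using h
      prefix_closed := by
        intro u b hu
        have hu' : (D.label ((v ++ u) ++ [b])).isSome := by
          rw [List.append_assoc]; exact hu
        exact D.prefix_closed (v ++ u) b hu'
      ordered := by
        intro u hu
        have hu' : (D.label ((v ++ u) ++ [true])).isSome := by
          rw [List.append_assoc]; exact hu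
        have h2 := D.ordered (v ++ u) hu'
        show (D.label (v ++ (u ++ [false]))).isSome
        rw [← List.append_assoc]
        exact h2 }
  else node0 .hyp []

/-! ## Non-wellfounded boxes -/

/-- Splits a node into its number of leading `true`s and, if any, the rest of
the address after the first `false`. -/
def leadSplit : Node → ℕ × Option Node
  | [] => (0, none)
  | true :: w => ((leadSplit w).1 + 1, (leadSplit w).2)
  | false :: w => (0, some w)

lemma leadSplit_append_none (w : Node) (h : (leadSplit w).2 = none) :
    leadSplit (w ++ [true]) = ((leadSplit w).1 + 1, none) ∧
    leadSplit (w ++ [false]) = ((leadSplit w).1, some []) := by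
  induction w with
  | nil => exact ⟨rfl, rfl⟩
  | cons c w ih =>
    cases c with
    | false => exact absurd h (by simp [leadSplit])
    | true =>
      have h' : (leadSplit w).2 = none := by simpa [leadSplit] using h
      obtain ⟨h1, h2⟩ := ih h'
      constructor
      · show leadSplit (true :: (w ++ [true])) = _
        simp [leadSplit, h1]
      · show leadSplit (true :: (w ++ [false])) = _
        simp [leadSplit, h2]

lemma leadSplit_append_some (w u : Node) (h : (leadSplit w).2 = some u) (b : Bool) :
    leadSplit (w ++ [b]) = ((leadSplit w).1, some (u ++ [b])) := by
  induction w with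
  | nil => simp [leadSplit] at h
  | cons c w ih =>
    cases c with
    | false =>
      have hw : w = u := by simpa [leadSplit] using h
      subst hw
      simp [leadSplit]
    | true =>
      have h' : (leadSplit w).2 = some u := by simpa [leadSplit] using h
      have := ih h'
      show leadSplit (true :: (w ++ [b])) = _
      simp [leadSplit, this]

/-- The non-wellfounded box with conclusion `Γ`, whose `i`-th call is `g i`:
its main branch `{ε, 2, 22, …}` consists of `c!p` rules. -/
def nwbOf (Γ : Sequent) (g : ℕ → Coderivation) : Coderivation where
  label w := match (leadSplit w).2 with
    | none => some (.cp, Γ)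
    | some u => (g (leadSplit w).1).label u
  root_isSome := rfl
  prefix_closed := by
    intro w b h
    have h' : (match (leadSplit (w ++ [b])).2 with
      | none => some (RuleName.cp, Γ)
      | some u => (g (leadSplit (w ++ [b])).1).label u).isSome := h
    show (match (leadSplit w).2 with
      | none => some (RuleName.cp, Γ)
      | some u => (g (leadSplit w).1).label u).isSome
    rcases hw : (leadSplit w).2 with _ | u
    · rfl
    · have ha := leadSplit_append_some w u hw b
      rw [ha] at h'
      exact (g (leadSplit w).1).prefix_closed u b h'
  ordered := by
    intro w h
    have h' : (match (leadSplit (w ++ [true])).2 with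
      | none => some (RuleName.cp, Γ)
      | some u => (g (leadSplit (w ++ [true])).1).label u).isSome := h
    show (match (leadSplit (w ++ [false])).2 with
      | none => some (RuleName.cp, Γ)
      | some u => (g (leadSplit (w ++ [false])).1).label u).isSome
    rcases hw : (leadSplit w).2 with _ | u
    · have haf := (leadSplit_append_none w hw).2
      rw [haf]
      exact (g (leadSplit w).1).root_isSome
    · have hat := leadSplit_append_some w u hw true
      have haf := leadSplit_append_some w u hw false
      rw [hat] at h'
      rw [haf]
      exact (g (leadSplit w).1).ordered u h'

/-- The node `v` of `D` is the root of a non-wellfounded box. -/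
def IsNwbAt (D : Coderivation) (v : Node) : Prop :=
  ∀ n : ℕ, D.ruleAt (v ++ List.replicate n true) = some .cp

/-- Every `c!p` rule of `D` belongs to the main branch of a non-wellfounded box. -/
def CpInNwb (D : Coderivation) : Prop :=
  ∀ v, D.ruleAt v = some .cp →
    ∃ w k, v = w ++ List.replicate k true ∧ IsNwbAt D w

/-! ## Regularity and finite expandability -/

def Regular (D : Coderivation) : Prop :=
  {E : Coderivation | ∃ v, D.mem v ∧ E = D.subAt v}.Finite

def WeaklyRegular (D : Coderivation) : Prop :=
  {E : Coderivation | ∃ v, D.ruleAt v = some .cp ∧ E = D.subAt (v ++ [false])}.Finite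

def FinExp (D : Coderivation) : Prop :=
  ∀ β, InfBranch D β →
    {n : ℕ | D.ruleAt (brNode β n) = some .cut ∨ D.ruleAt (brNode β n) = some .qb}.Finite

/-- `rPLL∞`: regular, finitely expandable, progressing coderivations of `PLL∞`. -/
def rPLL (D : Coderivation) : Prop := PLLinf D ∧ Progressing D ∧ FinExp D ∧ Regular D

/-- `wrPLL∞`: weakly regular, finitely expandable, progressing coderivations of `PLL∞`. -/
def wrPLL (D : Coderivation) : Prop := PLLinf D ∧ Progressing D ∧ FinExp D ∧ WeaklyRegular D

def CutFree (D : Coderivation) : Prop := ∀ v, D.ruleAt v ≠ some .cut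

/-- No cut-elimination step applies: one premise of each cut is a `hyp`. -/
def Normal (D : Coderivation) : Prop :=
  ∀ v, D.ruleAt v = some .cut →
    D.ruleAt (v ++ [false]) = some .hyp ∨ D.ruleAt (v ++ [true]) = some .hyp

/-! ## Pruning and approximations -/

lemma prefix_snoc_cases {u v : Node} {x : Bool} (h : u <+: v ++ [x]) :
    u <+: v ∨ u = v ++ [x] := by
  rcases Nat.lt_or_ge u.length (v ++ [x]).length with hl | hl
  · left
    have hle : u.length ≤ v.length := by
      have := hl
      simp only [List.length_append, List.length_cons, List.length_nil] at this
      omega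
    exact List.prefix_of_prefix_length_le h (List.prefix_append v [x]) hle
  · right
    exact h.eq_of_length (le_antisymm h.length_le (le_trans hl (le_of_eq rfl)))

open Classical in
noncomputable def pruneLabel (D : Coderivation) (V : Set Node) (w : Node) :
    Option (RuleName × Sequent) :=
  if ∃ v ∈ V, v <+: w ∧ v ≠ w then none
  else if w ∈ V then (D.label w).map fun p => (.hyp, p.2)
  else D.label w

lemma pruneLabel_isSome {D : Coderivation} {V : Set Node} {w : Node}
    (h : (pruneLabel D V w).isSome) :
    (D.label w).isSome ∧ ¬ ∃ v ∈ V, v <+: w ∧ v ≠ w := by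
  classical
  unfold pruneLabel at h
  split_ifs at h with h1 h2
  · exact absurd h (by simp)
  · exact ⟨by simpa using h, h1⟩
  · exact ⟨h, h1⟩

-- Pruning: replace the sub-coderivations of `D` rooted at the nodes of `V` by `hyp`.
open Classical in
noncomputable def prune (D : Coderivation) (V : Set Node) : Coderivation where
  label := pruneLabel D V
  root_isSome := by
    classical
    unfold pruneLabel
    split_ifs with h1 h2
    · exfalso
      obtain ⟨v, _, hpre, hne⟩ := h1
      exact hne (List.prefix_nil.mp hpre)
    · simpa using D.root_isSome
    · exact D.root_isSome
  prefix_closed := by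
    classical
    intro v b h
    obtain ⟨hD, hno⟩ := pruneLabel_isSome h
    have hDv : (D.label v).isSome := D.prefix_closed v b hD
    have hnov : ¬ ∃ u ∈ V, u <+: v ∧ u ≠ v := by
      rintro ⟨u, hu, hpre, hne⟩
      refine hno ⟨u, hu, hpre.trans (List.prefix_append _ _), fun he => ?_⟩
      have hlen := congrArg List.length he
      have hle : u.length ≤ v.length := hpre.length_le
      simp only [List.length_append, List.length_cons, List.length_nil] at hlen
      omega
    have hvnotV : v ∉ V := by
      intro hv
      refine hno ⟨v, hv, List.prefix_append _ _, fun he => ?_⟩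
      have hlen := congrArg List.length he
      simp only [List.length_append, List.length_cons, List.length_nil] at hlen
      omega
    show (pruneLabel D V v).isSome
    unfold pruneLabel
    rw [if_neg hnov, if_neg hvnotV]
    exact hDv
  ordered := by
    classical
    intro v h
    obtain ⟨hDt, hno⟩ := pruneLabel_isSome h
    have hDf : (D.label (v ++ [false])).isSome := D.ordered v hDt
    have hno' : ¬ ∃ u ∈ V, u <+: v ++ [false] ∧ u ≠ v ++ [false] := by
      rintro ⟨u, hu, hpre, hne⟩
      rcases prefix_snoc_cases hpre with hu_v | heq
      · rcases eq_or_ne u v with rfl | hne'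
        · refine hno ⟨u, hu, List.prefix_append _ _, fun he => ?_⟩
          have hlen := congrArg List.length he
          simp only [List.length_append, List.length_cons, List.length_nil] at hlen
          omega
        · refine hno ⟨u, hu, hu_v.trans (List.prefix_append _ _), fun he => ?_⟩
          have hlen := congrArg List.length he
          have hle : u.length ≤ v.length := hu_v.length_le
          simp only [List.length_append, List.length_cons, List.length_nil] at hlen
          omega
      · exact hne heq
    show (pruneLabel D V (v ++ [false])).isSome
    unfold pruneLabel
    rw [if_neg hno']
    by_cases hmem : v ++ [false] ∈ V
    · rw [if_pos hmem]
      simpa using hDf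
    · rw [if_neg hmem]
      exact hDf

/-- `E` approximates `D`: `E` is obtained from `D` by pruning at a set of
pairwise incomparable nodes. -/
def Approx (E D : Coderivation) : Prop :=
  ∃ V : Set Node, (∀ v ∈ V, ∀ w ∈ V, v <+: w → v = w) ∧ E = prune D V

/-- The greatest cut-free approximation of `D`: prune at the minimal cut nodes. -/
noncomputable def cf (D : Coderivation) : Coderivation :=
  prune D {v | D.ruleAt v = some .cut ∧
    ∀ w, w <+: v → w ≠ v → D.ruleAt w ≠ some .cut}

/-! ## Suprema of countable families of open coderivations -/

open Classical in
noncomputable def chainSupLabel (s : ℕ → Coderivation) (w : Node) :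
    Option (RuleName × Sequent) :=
  if h : ∃ i, ((s i).label w).isSome ∧ (s i).ruleAt w ≠ some .hyp then (s h.choose).label w
  else if h2 : ∃ i, ((s i).label w).isSome then (s h2.choose).label w
  else none

lemma chainSupLabel_isSome (s : ℕ → Coderivation) (w : Node) :
    (chainSupLabel s w).isSome ↔ ∃ i, ((s i).label w).isSome := by
  classical
  unfold chainSupLabel
  split_ifs with h1 h2
  · exact ⟨fun _ => ⟨h1.choose, h1.choose_spec.1⟩, fun _ => h1.choose_spec.1⟩
  · exact ⟨fun _ => h2, fun _ => h2.choose_spec⟩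
  · simp [h2]

/-- The supremum of a countable (increasing) family of open coderivations. -/
noncomputable def chainSup (s : ℕ → Coderivation) : Coderivation where
  label := chainSupLabel s
  root_isSome := (chainSupLabel_isSome s []).mpr ⟨0, (s 0).root_isSome⟩
  prefix_closed := by
    intro v b h
    obtain ⟨i, hi⟩ := (chainSupLabel_isSome s _).mp h
    exact (chainSupLabel_isSome s v).mpr ⟨i, (s i).prefix_closed v b hi⟩
  ordered := by
    intro v h
    obtain ⟨i, hi⟩ := (chainSupLabel_isSome s _).mp h
    exact (chainSupLabel_isSome s _).mpr ⟨i, (s i).ordered v hi⟩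

/-! ## Cut elimination steps -/

/-- Iterated weakenings introducing `?Γ` over `E` (of conclusion `Δ`). -/
def weakAll : List Formula → Sequent → Coderivation → Coderivation
  | [], _, E => E
  | A :: Γ, Δ, E => node1 .qw (A.quest :: (Γ.map .quest ++ Δ)) (weakAll Γ Δ E)

/-- Iterated absorptions absorbing the formulas of `Γ`; the root has conclusion `C`. -/
def absAll : List Formula → Sequent → Coderivation → Coderivation
  | [], _, E => E
  | A :: Γ, C, E => node1 .qb C (absAll Γ (A :: C) E)

/-- Root cut-elimination steps (principal and commutative). -/
inductive StepRoot : Coderivation → Coderivation → Prop where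
  | ax (A : Formula) (Δ : Sequent) (E : Coderivation)
      (hE : E.conclusion = A.neg :: Δ) :
      StepRoot (node2 .cut (A.neg :: Δ) (node0 .ax [A, A.neg]) E) E
  | tens_parr (A B : Formula) (Γ Δ Θ : Sequent) (D E₁ E₂ : Coderivation)
      (hD : D.conclusion = A :: B :: Γ)
      (hE₁ : E₁.conclusion = A.neg :: Δ) (hE₂ : E₂.conclusion = B.neg :: Θ) :
      StepRoot
        (node2 .cut (Γ ++ (Δ ++ Θ))
          (node1 .parr (A.parr B :: Γ) D)
          (node2 .tens (A.neg.tens B.neg :: (Δ ++ Θ)) E₁ E₂))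
        (node2 .cut (Γ ++ (Δ ++ Θ))
          (node2 .cut (B :: (Γ ++ Δ)) D E₁) E₂)
  | one_bot (Γ : Sequent) (D : Coderivation) (hD : D.conclusion = Γ) :
      StepRoot (node2 .cut Γ (node1 .bot (.bot :: Γ) D) (node0 .one [.one])) D
  | cp_cp (A B : Formula) (Γ Δ : Sequent) (D₁ D₂ E₁ E₂ : Coderivation)
      (hD₁ : D₁.conclusion = A :: Γ)
      (hD₂ : D₂.conclusion = A.bang :: Γ.map .quest)
      (hE₁ : E₁.conclusion = B :: A.neg :: Δ)
      (hE₂ : E₂.conclusion = B.bang :: A.neg.quest :: Δ.map .quest) :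
      StepRoot
        (node2 .cut (B.bang :: (Γ ++ Δ).map .quest)
          (node2 .cp (A.bang :: Γ.map .quest) D₁ D₂)
          (node2 .cp (B.bang :: A.neg.quest :: Δ.map .quest) E₁ E₂))
        (node2 .cp (B.bang :: (Γ ++ Δ).map .quest)
          (node2 .cut (B :: (Γ ++ Δ)) D₁ E₁)
          (node2 .cut (B.bang :: (Γ ++ Δ).map .quest) D₂ E₂))
  | cp_qw (A : Formula) (Γ Δ : Sequent) (D₁ D₂ E : Coderivation)
      (hD₁ : D₁.conclusion = A :: Γ)
      (hD₂ : D₂.conclusion = A.bang :: Γ.map .quest)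
      (hE : E.conclusion = Δ) :
      StepRoot
        (node2 .cut (Γ.map .quest ++ Δ)
          (node2 .cp (A.bang :: Γ.map .quest) D₁ D₂)
          (node1 .qw (A.neg.quest :: Δ) E))
        (weakAll Γ Δ E)
  | cp_qb (A : Formula) (Γ Δ : Sequent) (D₁ D₂ E : Coderivation)
      (hD₁ : D₁.conclusion = A :: Γ)
      (hD₂ : D₂.conclusion = A.bang :: Γ.map .quest)
      (hE : E.conclusion = A.neg :: A.neg.quest :: Δ) :
      StepRoot
        (node2 .cut (Γ.map .quest ++ Δ)
          (node2 .cp (A.bang :: Γ.map .quest) D₁ D₂)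
          (node1 .qb (A.neg.quest :: Δ) E))
        (absAll Γ (Γ.map .quest ++ Δ)
          (node2 .cut (Γ ++ (Γ.map .quest ++ Δ)) D₁
            (node2 .cut (A.neg :: (Γ.map .quest ++ Δ)) D₂ E)))
  | fp_fp (A B : Formula) (Γ Δ : Sequent) (D E : Coderivation)
      (hD : D.conclusion = A :: Γ) (hE : E.conclusion = B :: A.neg :: Δ) :
      StepRoot
        (node2 .cut (B.bang :: (Γ ++ Δ).map .quest)
          (node1 .fp (A.bang :: Γ.map .quest) D)
          (node1 .fp (B.bang :: A.neg.quest :: Δ.map .quest) E))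
        (node1 .fp (B.bang :: (Γ ++ Δ).map .quest)
          (node2 .cut (B :: (Γ ++ Δ)) D E))
  | fp_qw (A : Formula) (Γ Δ : Sequent) (D E : Coderivation)
      (hD : D.conclusion = A :: Γ) (hE : E.conclusion = Δ) :
      StepRoot
        (node2 .cut (Γ.map .quest ++ Δ)
          (node1 .fp (A.bang :: Γ.map .quest) D)
          (node1 .qw (A.neg.quest :: Δ) E))
        (weakAll Γ Δ E)
  | fp_qb (A : Formula) (Γ Δ : Sequent) (D E : Coderivation)
      (hD : D.conclusion = A :: Γ) (hE : E.conclusion = A.neg :: A.neg.quest :: Δ) :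
      StepRoot
        (node2 .cut (Γ.map .quest ++ Δ)
          (node1 .fp (A.bang :: Γ.map .quest) D)
          (node1 .qb (A.neg.quest :: Δ) E))
        (absAll Γ (Γ.map .quest ++ Δ)
          (node2 .cut (Γ ++ (Γ.map .quest ++ Δ)) D
            (node2 .cut (A.neg :: (Γ.map .quest ++ Δ))
              (node1 .fp (A.bang :: Γ.map .quest) D) E)))
  | comm1 (r : RuleName) (A : Formula) (Γ Γ' Δ : Sequent) (D E : Coderivation)
      (hr : r ≠ .cut)
      (h1 : RuleOk r (A :: Γ) [A :: Γ'])
      (h2 : RuleOk r (Γ ++ Δ) [Γ' ++ Δ])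
      (hD : D.conclusion = A :: Γ') (hE : E.conclusion = A.neg :: Δ) :
      StepRoot (node2 .cut (Γ ++ Δ) (node1 r (A :: Γ) D) E)
               (node1 r (Γ ++ Δ) (node2 .cut (Γ' ++ Δ) D E))
  | comm2a (r : RuleName) (A : Formula) (Γ Γ₁ Γ₂ Δ : Sequent) (D₁ D₂ E : Coderivation)
      (hr : r ≠ .cut)
      (h1 : RuleOk r (A :: Γ) [A :: Γ₁, Γ₂])
      (h2 : RuleOk r (Γ ++ Δ) [Γ₁ ++ Δ, Γ₂])
      (hD₁ : D₁.conclusion = A :: Γ₁) (hE : E.conclusion = A.neg :: Δ) :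
      StepRoot (node2 .cut (Γ ++ Δ) (node2 r (A :: Γ) D₁ D₂) E)
               (node2 r (Γ ++ Δ) (node2 .cut (Γ₁ ++ Δ) D₁ E) D₂)
  | comm2b (r : RuleName) (A : Formula) (Γ Γ₁ Γ₂ Δ : Sequent) (D₁ D₂ E : Coderivation)
      (hr : r ≠ .cut)
      (h1 : RuleOk r (A :: Γ) [Γ₁, A :: Γ₂])
      (h2 : RuleOk r (Γ ++ Δ) [Γ₁, Γ₂ ++ Δ])
      (hD₂ : D₂.conclusion = A :: Γ₂) (hE : E.conclusion = A.neg :: Δ) :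
      StepRoot (node2 .cut (Γ ++ Δ) (node2 r (A :: Γ) D₁ D₂) E)
               (node2 r (Γ ++ Δ) D₁ (node2 .cut (Γ₂ ++ Δ) D₂ E))
  | comm1r (r : RuleName) (A : Formula) (Γ Δ Δ' : Sequent) (D E : Coderivation)
      (hr : r ≠ .cut)
      (h1 : RuleOk r (A.neg :: Δ) [A.neg :: Δ'])
      (h2 : RuleOk r (Γ ++ Δ) [Γ ++ Δ'])
      (hD : D.conclusion = A :: Γ) (hE : E.conclusion = A.neg :: Δ') :
      StepRoot (node2 .cut (Γ ++ Δ) D (node1 r (A.neg :: Δ) E))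
               (node1 r (Γ ++ Δ) (node2 .cut (Γ ++ Δ') D E))
  | comm2ra (r : RuleName) (A : Formula) (Γ Δ Δ₁ Δ₂ : Sequent) (D E₁ E₂ : Coderivation)
      (hr : r ≠ .cut)
      (h1 : RuleOk r (A.neg :: Δ) [A.neg :: Δ₁, Δ₂])
      (h2 : RuleOk r (Γ ++ Δ) [Γ ++ Δ₁, Δ₂])
      (hD : D.conclusion = A :: Γ) (hE₁ : E₁.conclusion = A.neg :: Δ₁) :
      StepRoot (node2 .cut (Γ ++ Δ) D (node2 r (A.neg :: Δ) E₁ E₂))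
               (node2 r (Γ ++ Δ) (node2 .cut (Γ ++ Δ₁) D E₁) E₂)
  | comm2rb (r : RuleName) (A : Formula) (Γ Δ Δ₁ Δ₂ : Sequent) (D E₁ E₂ : Coderivation)
      (hr : r ≠ .cut)
      (h1 : RuleOk r (A.neg :: Δ) [Δ₁, A.neg :: Δ₂])
      (h2 : RuleOk r (Γ ++ Δ) [Δ₁, Γ ++ Δ₂])
      (hD : D.conclusion = A :: Γ) (hE₂ : E₂.conclusion = A.neg :: Δ₂) :
      StepRoot (node2 .cut (Γ ++ Δ) D (node2 r (A.neg :: Δ) E₁ E₂))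
               (node2 r (Γ ++ Δ) E₁ (node2 .cut (Γ ++ Δ₂) D E₂))

/-- A cut-elimination step performed at node `v`. -/
inductive StepAt : Node → Coderivation → Coderivation → Prop where
  | here {D E : Coderivation} : StepRoot D E → StepAt [] D E
  | in1 {v : Node} {D D' : Coderivation} (r : RuleName) (Γ : Sequent) :
      StepAt v D D' → StepAt (false :: v) (node1 r Γ D) (node1 r Γ D')
  | in2l {v : Node} {D D' : Coderivation} (r : RuleName) (Γ : Sequent) (E : Coderivation) :
      StepAt v D D' → StepAt (false :: v) (node2 r Γ D E) (node2 r Γ D' E)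
  | in2r {v : Node} {E E' : Coderivation} (r : RuleName) (Γ : Sequent) (D : Coderivation) :
      StepAt v E E' → StepAt (true :: v) (node2 r Γ D E) (node2 r Γ D E')

/-- One step of cut elimination. -/
def Step (D E : Coderivation) : Prop := ∃ v, StepAt v D E

/-! ## Infinitary cut-elimination strategies -/

/-- Upper bound for the approximation order. -/
def IsUB (S : Set Coderivation) (u : Coderivation) : Prop := ∀ x ∈ S, Approx x u

/-- Least upper bound for the approximation order. -/
def IsLubA (S : Set Coderivation) (u : Coderivation) : Prop :=
  IsUB S u ∧ ∀ w, IsUB S w → Approx u w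

/-- Scott continuity with respect to the approximation order. -/
def ScottCont (f : Coderivation → Coderivation) : Prop :=
  (∀ D E, Approx D E → Approx (f D) (f E)) ∧
  ∀ S u, S.Nonempty → DirectedOn Approx S → IsLubA S u → IsLubA (f '' S) (f u)

/-- An infinitary cut-elimination strategy: for each open coderivation `D`, a
reduction sequence `σ_D` of length `len D ≤ ω`, starting at `D`, performing a
cut-elimination step at each stage, and constant after `len D`. -/
structure Ices where
  seq : Coderivation → ℕ → Coderivation
  len : Coderivation → ℕ∞
  seq_zero : ∀ D, seq D 0 = D
  seq_step : ∀ D (i : ℕ), (i : ℕ∞) < len D → Step (seq D i) (seq D (i + 1))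
  seq_stable : ∀ D (i : ℕ), len D ≤ (i : ℕ∞) → seq D (i + 1) = seq D i

/-- The function computed by an ices: the supremum of the greatest cut-free
approximations along the reduction sequence. -/
noncomputable def fIces (σ : Ices) (D : Coderivation) : Coderivation :=
  chainSup fun i => cf (σ.seq D i)

/-- Maximality: on (finite) open derivations the strategy reaches a normal form. -/
def Ices.Maximal (σ : Ices) : Prop :=
  ∀ D, OPLLinf D → D.IsFinite → ∃ n : ℕ, σ.len D = (n : ℕ∞) ∧ Normal (σ.seq D n)

/-- Maximal and continuous infinitary cut-elimination strategy (mc-ices). -/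
def Ices.IsMc (σ : Ices) : Prop := σ.Maximal ∧ ScottCont (fIces σ)

/-! ## The height-by-height strategy -/

/-- Code of a node: smaller codes mean smaller height, and for equal heights,
more to the left. -/
def nodeCode (v : Node) : ℕ := v.foldl (fun n b => 2 * n + cond b 1 0) 1

open Classical in
noncomputable def hbhNext (D : Coderivation) : Coderivation :=
  if h : ∃ n, ∃ v E, StepAt v D E ∧ nodeCode v = n then
    (Nat.find_spec h).choose_spec.choose
  else D

/-- The height-by-height reduction sequence: at each stage, one cut-elimination
step is applied to the leftmost reducible cut of minimal height. -/
noncomputable def hbhSeq (D : Coderivation) : ℕ → Coderivation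
  | 0 => D
  | n + 1 => hbhNext (hbhSeq D n)

/-- `f_{σ∞}`, the function computed by the height-by-height strategy. -/
noncomputable def fHbh (D : Coderivation) : Coderivation :=
  chainSup fun i => cf (hbhSeq D i)

/-! ## The Scott domain of open coderivations -/

/-- Open coderivations with conclusion `Γ`. -/
def Dom (Γ : Sequent) : Set Coderivation := {D | OPLLinf D ∧ D.conclusion = Γ}

def IsLubOn (Γ : Sequent) (S : Set Coderivation) (u : Coderivation) : Prop :=
  u ∈ Dom Γ ∧ IsUB S u ∧ ∀ w ∈ Dom Γ, IsUB S w → Approx u w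

/-- Compactness in the domain of open coderivations with conclusion `Γ`. -/
def CompactOn (Γ : Sequent) (x : Coderivation) : Prop :=
  ∀ S, S ⊆ Dom Γ → S.Nonempty → DirectedOn Approx S →
    ∀ u, IsLubOn Γ S u → Approx x u → ∃ y ∈ S, Approx x y

/-- Maximality in the domain of open coderivations with conclusion `Γ`. -/
def MaxOn (Γ : Sequent) (x : Coderivation) : Prop :=
  ∀ y ∈ Dom Γ, Approx x y → x = y

/-! ## Relational semantics -/

/-- Codes for points of the relational model (`D_X := ℕ` for each variable):
`uStar` interprets units, `uEl` elements of the web of a variable, `uPair`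
pairs, `uMSet` finite multisets. -/
def uStar : ℕ := Nat.pair 0 0
def uEl (n : ℕ) : ℕ := Nat.pair 1 n
def uPair (a b : ℕ) : ℕ := Nat.pair 2 (Nat.pair a b)
noncomputable def uMSet (m : Multiset ℕ) : ℕ := Nat.pair 3 (Encodable.encode m)

/-- The web of a formula. -/
noncomputable def semF : Formula → Set ℕ
  | .var _ => Set.range uEl
  | .covar _ => Set.range uEl
  | .one => {uStar}
  | .bot => {uStar}
  | .tens A B => {x | ∃ a ∈ semF A, ∃ b ∈ semF B, x = uPair a b}
  | .parr A B => {x | ∃ a ∈ semF A, ∃ b ∈ semF B, x = uPair a b}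
  | .bang A => {x | ∃ m : Multiset ℕ, (∀ a ∈ m, a ∈ semF A) ∧ x = uMSet m}
  | .quest A => {x | ∃ m : Multiset ℕ, (∀ a ∈ m, a ∈ semF A) ∧ x = uMSet m}

/-- Pointwise merge of a tuple of elements into a tuple of multisets. -/
inductive MergeM : List ℕ → List ℕ → List ℕ → Prop where
  | nil : MergeM [] [] []
  | cons (x : ℕ) (m : Multiset ℕ) {xs ms ts : List ℕ} :
      MergeM xs ms ts → MergeM (x :: xs) (uMSet m :: ms) (uMSet (x ::ₘ m) :: ts)

/-- Transport of a tuple along a position alignment. -/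
def AlignedTuple (f : ℕ → ℕ) (t t₀ : List ℕ) : Prop :=
  t.length = t₀.length ∧ ∀ i, i < t.length → t₀[f i]? = t[i]?

/-- The semantic clause of each rule, on canonical instances; `S b` is the
(already transported) interpretation of premise `b`. -/
noncomputable def CanonSem : RuleName → Sequent → (Bool → Set (List ℕ)) → Set (List ℕ)
  | .ax, C₀, _ => {t | ∃ A x, C₀ = [A, A.neg] ∧ x ∈ semF A ∧ t = [x, x]}
  | .cut, _, S => {t | ∃ z u v, (z :: u) ∈ S false ∧ (z :: v) ∈ S true ∧ t = u ++ v}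
  | .tens, _, S =>
      {t | ∃ a b u v, (a :: u) ∈ S false ∧ (b :: v) ∈ S true ∧ t = uPair a b :: (u ++ v)}
  | .parr, _, S => {t | ∃ a b u, (a :: b :: u) ∈ S false ∧ t = uPair a b :: u}
  | .one, _, _ => {[uStar]}
  | .bot, _, S => {t | ∃ u ∈ S false, t = uStar :: u}
  | .qw, _, S => {t | ∃ u ∈ S false, t = uMSet 0 :: u}
  | .qb, _, S =>
      {t | ∃ y, ∃ μ : Multiset ℕ, ∃ u, (y :: uMSet μ :: u) ∈ S false ∧ t = uMSet (y ::ₘ μ) :: u}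
  | .cp, C₀, S =>
      {t | t = List.replicate C₀.length (uMSet 0)} ∪
      {t | ∃ x xs m ms ts, (x :: xs) ∈ S false ∧ (uMSet m :: ms) ∈ S true ∧
        MergeM xs ms ts ∧ t = uMSet (x ::ₘ m) :: ts}
  | .dig, _, S =>
      {t | ∃ ms : List (Multiset ℕ), ∃ u,
        (uMSet ((ms.map uMSet : List ℕ) : Multiset ℕ) :: u) ∈ S false ∧
        t = uMSet ms.sum :: u}
  | _, _, _ => ∅

/-- The `n`-th finite stage of the relational interpretation of a coderivation. -/
noncomputable def interpN : ℕ → Coderivation → Set (List ℕ)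
  | 0, _ => ∅
  | n + 1, D =>
    {t | ∃ r C C₀ ps₀ f t₀,
      D.label [] = some (r, C) ∧ Canon r C₀ ps₀ ∧ PosAlign C C₀ f ∧
      AlignedTuple f t t₀ ∧
      t₀ ∈ CanonSem r C₀ (fun b =>
        {u₀ | ∃ P P₀ g u, D.seqAt [b] = some P ∧ ps₀[bIdx b]? = some P₀ ∧
          PosAlign P P₀ g ∧ AlignedTuple g u u₀ ∧ u ∈ interpN n (D.subAt [b])})}

/-- The relational interpretation `⟦D⟧` of a coderivation. -/
noncomputable def interp (D : Coderivation) : Set (List ℕ) := ⋃ n, interpN n D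

/-! ## Finite (wellfounded) derivations of `PLL` and `nuPLL`, and their translations -/

/-- Finite derivation trees (for `PLL`). -/
inductive PDeriv : Type where
  | p0 (r : RuleName) (Γ : Sequent) : PDeriv
  | p1 (r : RuleName) (Γ : Sequent) (D : PDeriv) : PDeriv
  | p2 (r : RuleName) (Γ : Sequent) (D E : PDeriv) : PDeriv

def PDeriv.concl : PDeriv → Sequent
  | .p0 _ Γ => Γ
  | .p1 _ Γ _ => Γ
  | .p2 _ Γ _ _ => Γ

/-- Valid derivations of the sequent calculus `PLL`. -/
inductive PValid : PDeriv → Prop where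
  | p0 (r : RuleName) (Γ : Sequent) :
      r ∈ pllRules → RuleOk r Γ [] → PValid (.p0 r Γ)
  | p1 (r : RuleName) (Γ : Sequent) (D : PDeriv) :
      r ∈ pllRules → RuleOk r Γ [D.concl] → PValid D → PValid (.p1 r Γ D)
  | p2 (r : RuleName) (Γ : Sequent) (D E : PDeriv) :
      r ∈ pllRules → RuleOk r Γ [D.concl, E.concl] → PValid D → PValid E →
      PValid (.p2 r Γ D E)

/-- The translation `(·)° : PLL → PLL∞`, unfolding each functorial promotion
into a non-wellfounded box all of whose calls are equal. -/
def PDeriv.toCo : PDeriv → Coderivation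
  | .p0 r Γ => node0 r Γ
  | .p1 r Γ D => if r = .fp then nwbOf Γ (fun _ => D.toCo) else node1 r Γ D.toCo
  | .p2 r Γ D E => node2 r Γ D.toCo E.toCo

/-- Wellfounded, infinitely-branching derivation trees (for `nuPLL`). -/
inductive NDeriv : Type where
  | n0 (r : RuleName) (Γ : Sequent) : NDeriv
  | n1 (r : RuleName) (Γ : Sequent) (D : NDeriv) : NDeriv
  | n2 (r : RuleName) (Γ : Sequent) (D E : NDeriv) : NDeriv
  | nup (Γ : Sequent) (f : ℕ → NDeriv) : NDeriv

def NDeriv.concl : NDeriv → Sequent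
  | .n0 _ Γ => Γ
  | .n1 _ Γ _ => Γ
  | .n2 _ Γ _ _ => Γ
  | .nup Γ _ => Γ

def nupllRules : Set RuleName := {.ax, .cut, .tens, .parr, .one, .bot, .qw, .qb}

/-- Valid derivations of `nuPLL`: the infinitely branching promotion `ν!p` has
countably many premises with the same conclusion, finitely many of which are
distinct. -/
inductive NValid : NDeriv → Prop where
  | n0 (r : RuleName) (Γ : Sequent) :
      r ∈ nupllRules → RuleOk r Γ [] → NValid (.n0 r Γ)
  | n1 (r : RuleName) (Γ : Sequent) (D : NDeriv) :
      r ∈ nupllRules → RuleOk r Γ [D.concl] → NValid D → NValid (.n1 r Γ D)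
  | n2 (r : RuleName) (Γ : Sequent) (D E : NDeriv) :
      r ∈ nupllRules → RuleOk r Γ [D.concl, E.concl] → NValid D → NValid E →
      NValid (.n2 r Γ D E)
  | nup (Γ : Sequent) (f : ℕ → NDeriv) :
      (∀ i, NValid (f i)) → (Set.range f).Finite →
      (∀ i, (f i).concl = (f 0).concl) →
      RuleOk .fp Γ [(f 0).concl] →
      NValid (.nup Γ f)

/-- The translation `(·)• : nuPLL → PLL∞`, unfolding each `ν!p` with premises
`(D_i)` into the non-wellfounded box whose `i`-th call is `D_i•`. -/
def NDeriv.toCo : NDeriv → Coderivation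
  | .n0 r Γ => node0 r Γ
  | .n1 r Γ D => node1 r Γ D.toCo
  | .n2 r Γ D E => node2 r Γ D.toCo E.toCo
  | .nup Γ f => nwbOf Γ (fun i => (f i).toCo)

/-! ## The digging counterexample -/

def fX : Formula := .var 0

/-- `N := !(X ⊸ X) ⊸ X ⊸ X = ?(X ⊗ X^⊥) ⅋ (X^⊥ ⅋ X)`. -/
def fN : Formula := (Formula.quest (fX.tens fX.neg)).parr (fX.neg.parr fX)

/-- The derivation `0` of `⊢ N` (weakening over an axiom). -/
def cod0 : Coderivation :=
  node1 .parr [fN]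
    (node1 .parr [.quest (fX.tens fX.neg), fX.neg.parr fX]
      (node1 .qw [.quest (fX.tens fX.neg), fX.neg, fX]
        (node0 .ax [fX.neg, fX])))

/-- The derivation `1` of `⊢ N` (absorption over a weakened tensor of axioms). -/
def cod1 : Coderivation :=
  node1 .parr [fN]
    (node1 .parr [.quest (fX.tens fX.neg), fX.neg.parr fX]
      (node1 .qb [.quest (fX.tens fX.neg), fX.neg, fX]
        (node1 .qw [fX.tens fX.neg, .quest (fX.tens fX.neg), fX.neg, fX]
          (node2 .tens [fX.tens fX.neg, fX.neg, fX]
            (node0 .ax [fX, fX.neg])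
            (node0 .ax [fX.neg, fX])))))

/-- The non-wellfounded box `⟨0,1,0,1,…⟩` of conclusion `⊢ !N`. -/
def boxAlt : Coderivation := nwbOf [fN.bang] fun i => if i % 2 = 0 then cod0 else cod1

/-- Digging applied to the axiom `⊢ ??N^⊥, !!N`. -/
def digCo : Coderivation :=
  node1 .dig [fN.neg.quest, fN.bang.bang]
    (node0 .ax [fN.neg.quest.quest, fN.bang.bang])

/-- The coderivation `D_??d` of `⊢ !!N`. -/
def Ddig : Coderivation := node2 .cut [fN.bang.bang] boxAlt digCo

/-! ## The approximation order, node by node -/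

lemma Coderivation.eq_of_label {D E : Coderivation} (h : ∀ w, D.label w = E.label w) : D = E := by
  cases D
  cases E
  simp only [Coderivation.mk.injEq]
  exact funext h

lemma pruneLabel_of_below {D : Coderivation} {V : Set Node} {w : Node}
    (h : ∃ v ∈ V, v <+: w ∧ v ≠ w) : pruneLabel D V w = none := by
  unfold pruneLabel
  rw [if_pos h]

lemma pruneLabel_of_mem {D : Coderivation} {V : Set Node} {w : Node}
    (h : ¬ ∃ v ∈ V, v <+: w ∧ v ≠ w) (hw : w ∈ V) :
    pruneLabel D V w = (D.label w).map fun p => (.hyp, p.2) := by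
  unfold pruneLabel
  rw [if_neg h, if_pos hw]

lemma pruneLabel_of_notMem {D : Coderivation} {V : Set Node} {w : Node}
    (h : ¬ ∃ v ∈ V, v <+: w ∧ v ≠ w) (hw : w ∉ V) : pruneLabel D V w = D.label w := by
  unfold pruneLabel
  rw [if_neg h, if_neg hw]

lemma exists_minimal_below {V : Set Node} {w : Node} (hw : w ∈ V) :
    ∃ v ∈ V, v <+: w ∧ ∀ u ∈ V, u <+: v → u = v := by
  induction hn : w.length using Nat.strong_induction_on generalizing w with
  | _ n ih =>
    by_cases hmin : ∀ u ∈ V, u <+: w → u = w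
    · exact ⟨w, hw, List.prefix_refl w, hmin⟩
    · push Not at hmin
      obtain ⟨u, hu, hpre, hne⟩ := hmin
      have hlt : u.length < n :=
        hn ▸ lt_of_le_of_ne hpre.length_le fun he => hne (hpre.eq_of_length he)
      obtain ⟨v, hv, hvu, hvmin⟩ := ih _ hlt hu rfl
      exact ⟨v, hv, hvu.trans hpre, hvmin⟩

/-- Only the prefix-minimal nodes of `V` matter for pruning. -/
lemma prune_eq_prune_minimal (D : Coderivation) (V : Set Node) :
    prune D V = prune D {v | v ∈ V ∧ ∀ u ∈ V, u <+: v → u = v} := by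
  set M : Set Node := {v | v ∈ V ∧ ∀ u ∈ V, u <+: v → u = v}
  refine Coderivation.eq_of_label fun w => ?_
  change pruneLabel D V w = pruneLabel D M w
  by_cases h : ∃ v ∈ V, v <+: w ∧ v ≠ w
  · rw [pruneLabel_of_below h]
    obtain ⟨v, hv, hvw, hne⟩ := h
    obtain ⟨u, hu, huv, hmin⟩ := exists_minimal_below hv
    refine (pruneLabel_of_below (V := M) ⟨u, ⟨hu, hmin⟩, huv.trans hvw, ?_⟩).symm
    rintro rfl
    exact hne (hvw.eq_of_length (le_antisymm hvw.length_le huv.length_le))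
  · have hM : ¬ ∃ v ∈ M, v <+: w ∧ v ≠ w := fun ⟨v, hv, h'⟩ => h ⟨v, hv.1, h'⟩
    by_cases hw : w ∈ V
    · have hwM : w ∈ M := ⟨hw, fun u hu hpre => by_contra fun hne => h ⟨u, hu, hpre, hne⟩⟩
      rw [pruneLabel_of_mem h hw, pruneLabel_of_mem hM hwM]
    · rw [pruneLabel_of_notMem h hw, pruneLabel_of_notMem hM fun hwM => hw hwM.1]

lemma prune_prune (D : Coderivation) (V W : Set Node) :
    prune (prune D W) V = prune D (V ∪ W) := by
  refine Coderivation.eq_of_label fun w => ?_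
  change pruneLabel (prune D W) V w = pruneLabel D (V ∪ W) w
  by_cases hV : ∃ v ∈ V, v <+: w ∧ v ≠ w
  · obtain ⟨v, hv, h⟩ := id hV
    rw [pruneLabel_of_below hV, pruneLabel_of_below (V := V ∪ W) ⟨v, Or.inl hv, h⟩]
  by_cases hW : ∃ v ∈ W, v <+: w ∧ v ≠ w
  · obtain ⟨v, hv, h⟩ := id hW
    rw [pruneLabel_of_below (V := V ∪ W) ⟨v, Or.inr hv, h⟩]
    have hnone : (prune D W).label w = none := pruneLabel_of_below hW
    by_cases hw : w ∈ V
    · rw [pruneLabel_of_mem hV hw, hnone, Option.map_none]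
    · rw [pruneLabel_of_notMem hV hw, hnone]
  have hVW : ¬ ∃ v ∈ V ∪ W, v <+: w ∧ v ≠ w := by
    rintro ⟨v, hv | hv, h⟩
    · exact hV ⟨v, hv, h⟩
    · exact hW ⟨v, hv, h⟩
  by_cases hwV : w ∈ V
  · rw [pruneLabel_of_mem hV hwV, pruneLabel_of_mem hVW (Or.inl hwV)]
    change (pruneLabel D W w).map _ = _
    by_cases hwW : w ∈ W
    · rw [pruneLabel_of_mem hW hwW, Option.map_map]
      rfl
    · rw [pruneLabel_of_notMem hW hwW]
  · rw [pruneLabel_of_notMem hV hwV]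
    change pruneLabel D W w = _
    by_cases hwW : w ∈ W
    · rw [pruneLabel_of_mem hW hwW, pruneLabel_of_mem hVW (Or.inr hwW)]
    · rw [pruneLabel_of_notMem hW hwW, pruneLabel_of_notMem hVW fun h => h.elim hwV hwW]

lemma approx_prune (D : Coderivation) (V : Set Node) : Approx (prune D V) D := by
  refine ⟨_, ?_, prune_eq_prune_minimal D V⟩
  rintro v ⟨hv, -⟩ w ⟨-, hw⟩ hvw
  exact hw v hv hvw

lemma approx_refl (D : Coderivation) : Approx D D := by
  refine ⟨∅, by simp, Coderivation.eq_of_label fun w => ?_⟩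
  exact (pruneLabel_of_notMem (by simp) (by simp)).symm

lemma approx_trans {D E F : Coderivation} (h₁ : Approx D E) (h₂ : Approx E F) : Approx D F := by
  obtain ⟨V, -, rfl⟩ := h₁
  obtain ⟨W, -, rfl⟩ := h₂
  rw [prune_prune]
  exact approx_prune F _

/-- Every node of `E` is a node of `D` with the same sequent, and with the same rule unless it
is a `hyp` of `E`. -/
def NodewiseLe (E D : Coderivation) : Prop :=
  ∀ w r Δ, E.label w = some (r, Δ) → ∃ r', D.label w = some (r', Δ) ∧ (r = .hyp ∨ r' = r)

lemma Approx.nodewiseLe {E D : Coderivation} (h : Approx E D) : NodewiseLe E D := by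
  obtain ⟨V, -, rfl⟩ := h
  intro w r Δ hw
  change pruneLabel D V w = _ at hw
  by_cases hV : ∃ v ∈ V, v <+: w ∧ v ≠ w
  · simp [pruneLabel_of_below hV] at hw
  by_cases hwV : w ∈ V
  · rw [pruneLabel_of_mem hV hwV, Option.map_eq_some_iff] at hw
    obtain ⟨⟨r', Δ'⟩, hD, he⟩ := hw
    obtain ⟨rfl, rfl⟩ := Prod.mk.inj he
    exact ⟨r', hD, Or.inl rfl⟩
  · rw [pruneLabel_of_notMem hV hwV] at hw
    exact ⟨r, hw, Or.inr rfl⟩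

lemma NodewiseLe.antisymm {E D : Coderivation} (h₁ : NodewiseLe E D) (h₂ : NodewiseLe D E) :
    E = D := by
  have key : ∀ {E D : Coderivation}, NodewiseLe E D → NodewiseLe D E →
      ∀ w p, E.label w = some p → D.label w = some p := by
    rintro E D h₁ h₂ w ⟨r, Δ⟩ hw
    obtain ⟨r', hD, h⟩ := h₁ w r Δ hw
    obtain ⟨r'', hE, h'⟩ := h₂ w r' Δ hD
    obtain rfl : r = r'' := by simpa [hw] using hE
    rcases h with rfl | rfl
    · rcases h' with rfl | rfl <;> exact hD
    · exact hD
  refine Coderivation.eq_of_label fun w => Option.ext fun p => ?_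
  exact ⟨key h₁ h₂ w p, key h₂ h₁ w p⟩

/-! ## Arity of rules -/

def RuleName.arity : RuleName → ℕ
  | .ax | .one | .hyp => 0
  | .parr | .bot | .qw | .qb | .fp | .dig => 1
  | .cut | .tens | .cp => 2

lemma RuleOk.length_eq {r : RuleName} {C : Sequent} {ps : List Sequent} (h : RuleOk r C ps) :
    ps.length = r.arity := by
  obtain ⟨C₀, ps₀, hc, -, hps⟩ := h
  rw [hps.length_eq]
  cases hc <;> rfl

lemma ruleOk_hyp (Δ : Sequent) : RuleOk .hyp Δ [] :=
  ⟨Δ, [], .hyp Δ, .refl Δ, .nil⟩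

lemma Coderivation.IsOver.child_isSome_iff {D : Coderivation} {R : Set RuleName}
    (hD : D.IsOver R) {w : Node} {r : RuleName} {Δ : Sequent} (hw : D.label w = some (r, Δ))
    (b : Bool) : (D.label (w ++ [b])).isSome ↔ bIdx b < r.arity := by
  have hlen := (hD w r Δ hw).2.length_eq
  have hord := D.ordered w
  simp only [Coderivation.premsAt, Coderivation.seqAt] at hlen
  rcases hf : D.label (w ++ [false]) with _ | p <;> rcases ht : D.label (w ++ [true]) with _ | q <;>
    simp only [hf, ht] at hlen hord <;> cases b <;> simp_all [bIdx] <;> omega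

lemma Coderivation.premsAt_congr {D E : Coderivation} {w : Node}
    (h : ∀ b, D.seqAt (w ++ [b]) = E.seqAt (w ++ [b])) : D.premsAt w = E.premsAt w := by
  simp only [Coderivation.premsAt, h]

lemma Coderivation.premsAt_eq_nil {D : Coderivation} {w : Node}
    (h : ∀ b, D.label (w ++ [b]) = none) : D.premsAt w = [] := by
  simp [Coderivation.premsAt, Coderivation.seqAt, h]

lemma Coderivation.IsOver.hyp_leaf {D : Coderivation} {R : Set RuleName} (hD : D.IsOver R)
    {v : Node} {Δ : Sequent} (hv : D.label v = some (.hyp, Δ)) {w : Node} (hpre : v <+: w)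
    (hne : v ≠ w) : D.label w = none := by
  induction w using List.reverseRecOn with
  | nil => exact absurd (List.prefix_nil.mp hpre) hne
  | append_singleton w b ih =>
    rw [← Option.not_isSome_iff_eq_none]
    rcases prefix_snoc_cases hpre with hvw | he
    · by_cases hvw' : v = w
      · subst hvw'
        rw [hD.child_isSome_iff hv b]
        exact Nat.not_lt_zero _
      · intro hs
        simpa [ih hvw hvw'] using D.prefix_closed w b hs
    · exact absurd he hne

/-- A node of `D` missing from an open coderivation below `D` lies above a `hyp`. -/
lemma NodewiseLe.exists_hyp_below {E D : Coderivation} {R R' : Set RuleName}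
    (hE : E.IsOver R) (hD : D.IsOver R') (h : NodewiseLe E D) {w : Node}
    (hDw : (D.label w).isSome) (hEw : E.label w = none) :
    ∃ v Δ, v <+: w ∧ v ≠ w ∧ E.label v = some (.hyp, Δ) := by
  induction w using List.reverseRecOn with
  | nil => simpa [hEw] using E.root_isSome
  | append_singleton w b ih =>
    rcases hw : E.label w with _ | ⟨r, Δ⟩
    · obtain ⟨v, Δ, hvw, hne, hv⟩ := ih (D.prefix_closed w b hDw) hw
      refine ⟨v, Δ, hvw.trans (List.prefix_append _ _), ?_, hv⟩
      rintro rfl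
      simpa using hvw.length_le
    · obtain ⟨r', hDr, rfl | rfl⟩ := h w r Δ hw
      · exact ⟨w, Δ, List.prefix_append _ _, by simp, hw⟩
      · have := (hE.child_isSome_iff hw b).2 ((hD.child_isSome_iff hDr b).1 hDw)
        simp [hEw] at this

/-- On coderivations respecting the rules, approximation can be tested node by node. -/
lemma approx_iff_nodewiseLe {E D : Coderivation} {R R' : Set RuleName}
    (hE : E.IsOver R) (hD : D.IsOver R') : Approx E D ↔ NodewiseLe E D := by
  refine ⟨Approx.nodewiseLe, fun h => ?_⟩
  suffices he : E = prune D {v | ∃ Δ, E.label v = some (.hyp, Δ)} by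
    rw [he]
    exact approx_prune D _
  refine Coderivation.eq_of_label fun w => ?_
  change _ = pruneLabel D _ w
  by_cases hV : ∃ v ∈ {v | ∃ Δ, E.label v = some (.hyp, Δ)}, v <+: w ∧ v ≠ w
  · rw [pruneLabel_of_below hV]
    obtain ⟨v, ⟨Δ, hv⟩, hvw, hne⟩ := hV
    exact hE.hyp_leaf hv hvw hne
  by_cases hw : ∃ Δ, E.label w = some (.hyp, Δ)
  · rw [pruneLabel_of_mem hV hw]
    obtain ⟨Δ, hw⟩ := hw
    obtain ⟨r', hD', -⟩ := h w _ Δ hw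
    simp [hw, hD']
  · rw [pruneLabel_of_notMem hV hw]
    rcases hEw : E.label w with _ | ⟨r, Δ⟩
    · by_contra hne
      obtain ⟨v, Δ, hvw, hvne, hv⟩ :=
        h.exists_hyp_below hE hD (Option.isSome_iff_ne_none.2 (Ne.symm hne)) hEw
      exact hV ⟨v, ⟨Δ, hv⟩, hvw, hvne⟩
    · obtain ⟨r', hD', rfl | rfl⟩ := h w r Δ hEw
      · exact absurd ⟨Δ, hEw⟩ hw
      · exact hD'.symm

lemma exists_label_nil {Γ : Sequent} {D : Coderivation} (hD : D.conclusion = Γ) :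
    ∃ r, D.label [] = some (r, Γ) := by
  obtain ⟨⟨r, Δ⟩, h⟩ := Option.isSome_iff_exists.1 D.root_isSome
  refine ⟨r, ?_⟩
  simp only [Coderivation.conclusion, h] at hD
  simpa [← hD] using h

lemma conclusion_eq_of_label {Γ : Sequent} {D : Coderivation} {r : RuleName}
    (h : D.label [] = some (r, Γ)) : D.conclusion = Γ := by
  simp [Coderivation.conclusion, h]

/-! ## Suprema -/

open Classical in
/-- The label at `w` of the supremum of `S`: a label other than `hyp` is preferred. -/
noncomputable def supLabel (S : Set Coderivation) (w : Node) : Option (RuleName × Sequent) :=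
  if h : ∃ p, (∃ x ∈ S, x.label w = some p) ∧ p.1 ≠ .hyp then some h.choose
  else if h : ∃ p, ∃ x ∈ S, x.label w = some p then some h.choose
  else none

lemma exists_of_supLabel {S : Set Coderivation} {w : Node} {p : RuleName × Sequent}
    (h : supLabel S w = some p) : ∃ x ∈ S, x.label w = some p := by
  unfold supLabel at h
  split_ifs at h with h₁ h₂
  · exact Option.some.inj h ▸ h₁.choose_spec.1
  · exact Option.some.inj h ▸ h₂.choose_spec

lemma supLabel_isSome {S : Set Coderivation} {x : Coderivation} (hx : x ∈ S) {w : Node}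
    (h : (x.label w).isSome) : (supLabel S w).isSome := by
  obtain ⟨p, hp⟩ := Option.isSome_iff_exists.1 h
  unfold supLabel
  split_ifs with h₁ h₂
  · rfl
  · rfl
  · exact absurd ⟨p, x, hx, hp⟩ h₂

lemma hyp_of_supLabel_eq_hyp {S : Set Coderivation} {w : Node} {Δ : Sequent}
    (h : supLabel S w = some (.hyp, Δ)) {x : Coderivation} (hx : x ∈ S)
    {p : RuleName × Sequent} (hp : x.label w = some p) : p.1 = .hyp := by
  by_contra hne
  unfold supLabel at h
  have h₁ : ∃ p, (∃ x ∈ S, x.label w = some p) ∧ p.1 ≠ .hyp := ⟨p, ⟨x, hx, hp⟩, hne⟩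
  rw [dif_pos h₁] at h
  exact h₁.choose_spec.2 (Option.some.inj h ▸ rfl)

/-- The supremum of a nonempty family of coderivations. -/
noncomputable def supOf (S : Set Coderivation) (hS : S.Nonempty) : Coderivation where
  label := supLabel S
  root_isSome := supLabel_isSome hS.some_mem hS.some.root_isSome
  prefix_closed v b h := by
    obtain ⟨p, hp⟩ := Option.isSome_iff_exists.1 h
    obtain ⟨x, hx, hxp⟩ := exists_of_supLabel hp
    exact supLabel_isSome hx (x.prefix_closed v b (hxp ▸ rfl))
  ordered v h := by
    obtain ⟨p, hp⟩ := Option.isSome_iff_exists.1 h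
    obtain ⟨x, hx, hxp⟩ := exists_of_supLabel hp
    exact supLabel_isSome hx (x.ordered v (hxp ▸ rfl))

/-- Any two members of `S` have a common upper bound. -/
def PairwiseBounded (S : Set Coderivation) : Prop :=
  ∀ x ∈ S, ∀ y ∈ S, ∃ z, Approx x z ∧ Approx y z

lemma PairwiseBounded.compatible {S : Set Coderivation} (hS : PairwiseBounded S)
    {x y : Coderivation} (hx : x ∈ S) (hy : y ∈ S) {w : Node} {r r' : RuleName} {Δ Δ' : Sequent}
    (hxw : x.label w = some (r, Δ)) (hyw : y.label w = some (r', Δ')) :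
    Δ = Δ' ∧ (r = .hyp ∨ r' = .hyp ∨ r = r') := by
  obtain ⟨z, hxz, hyz⟩ := hS x hx y hy
  obtain ⟨s, hs, h⟩ := hxz.nodewiseLe w r Δ hxw
  obtain ⟨s', hs', h'⟩ := hyz.nodewiseLe w r' Δ' hyw
  obtain ⟨rfl, rfl⟩ : s = s' ∧ Δ = Δ' := by simpa [hs] using hs'
  refine ⟨rfl, ?_⟩
  rcases h with h | h
  · exact Or.inl h
  rcases h' with h' | h'
  · exact Or.inr (Or.inl h')
  · exact Or.inr (Or.inr (h.symm.trans h'))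

lemma PairwiseBounded.nodewiseLe_supOf {S : Set Coderivation} (hS : PairwiseBounded S)
    (hne : S.Nonempty) {x : Coderivation} (hx : x ∈ S) : NodewiseLe x (supOf S hne) := by
  intro w r Δ hw
  obtain ⟨⟨r', Δ'⟩, hp⟩ := Option.isSome_iff_exists.1 (supLabel_isSome hx (w := w) (by simp [hw]))
  obtain ⟨y, hy, hyw⟩ := exists_of_supLabel hp
  obtain ⟨rfl, h⟩ := hS.compatible hx hy hw hyw
  refine ⟨r', hp, ?_⟩
  rcases h with h | rfl | h
  · exact Or.inl h
  · exact Or.inl (hyp_of_supLabel_eq_hyp hp hx hw)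
  · exact Or.inr h.symm

lemma PairwiseBounded.supOf_mem_dom {Γ : Sequent} {S : Set Coderivation}
    (hS : PairwiseBounded S) (hne : S.Nonempty) (hΓ : S ⊆ Dom Γ) : supOf S hne ∈ Dom Γ := by
  constructor
  · intro w r Δ hw
    obtain ⟨x, hx, hxw⟩ := exists_of_supLabel hw
    have hxo := hΓ hx |>.1 w r Δ hxw
    refine ⟨hxo.1, ?_⟩
    suffices hp : (supOf S hne).premsAt w = x.premsAt w from hp ▸ hxo.2
    refine Coderivation.premsAt_congr fun b => ?_
    rcases hs : supLabel S (w ++ [b]) with _ | ⟨q, Θ⟩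
    · have hxn : x.label (w ++ [b]) = none := by
        rw [← Option.not_isSome_iff_eq_none]
        intro h
        simpa [hs] using supLabel_isSome hx h
      simp [Coderivation.seqAt, supOf, hs, hxn]
    · obtain ⟨y, hy, hyb⟩ := exists_of_supLabel hs
      have hyb' : (y.label (w ++ [b])).isSome := by simp [hyb]
      obtain ⟨⟨r', Δ'⟩, hyw⟩ := Option.isSome_iff_exists.1 (y.prefix_closed w b hyb')
      have har := ((hΓ hy).1.child_isSome_iff hyw b).1 hyb'
      have hr' : r' ≠ .hyp := by
        rintro rfl
        exact Nat.not_lt_zero _ har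
      obtain rfl : r = r' := by
        rcases (hS.compatible hx hy hxw hyw).2 with rfl | h | h
        · exact absurd (hyp_of_supLabel_eq_hyp hw hy hyw) hr'
        · exact absurd h hr'
        · exact h
      obtain ⟨⟨q', Θ'⟩, hxb⟩ := Option.isSome_iff_exists.1
        (((hΓ hx).1.child_isSome_iff hxw b).2 har)
      obtain rfl := (hS.compatible hx hy hxb hyb).1
      simp [Coderivation.seqAt, supOf, hs, hxb]
  · obtain ⟨x, hx⟩ := hne
    obtain ⟨r, hr⟩ := exists_label_nil (hΓ hx).2
    obtain ⟨r', hr', -⟩ := hS.nodewiseLe_supOf ⟨x, hx⟩ hx _ _ _ hr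
    exact conclusion_eq_of_label hr'

lemma PairwiseBounded.isLubOn_supOf {Γ : Sequent} {S : Set Coderivation}
    (hS : PairwiseBounded S) (hne : S.Nonempty) (hΓ : S ⊆ Dom Γ) :
    IsLubOn Γ S (supOf S hne) := by
  have hmem := hS.supOf_mem_dom hne hΓ
  refine ⟨hmem, fun x hx => ?_, fun z hz hub => ?_⟩
  · exact (approx_iff_nodewiseLe (hΓ hx).1 hmem.1).2 (hS.nodewiseLe_supOf hne hx)
  · refine (approx_iff_nodewiseLe hmem.1 hz.1).2 fun w r Δ hw => ?_
    obtain ⟨x, hx, hxw⟩ := exists_of_supLabel hw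
    exact (hub x hx).nodewiseLe w r Δ hxw

lemma approx_antisymm {D E : Coderivation} (h₁ : Approx D E) (h₂ : Approx E D) : D = E :=
  h₁.nodewiseLe.antisymm h₂.nodewiseLe

lemma pairwiseBounded_of_directedOn {S : Set Coderivation} (hS : DirectedOn Approx S) :
    PairwiseBounded S := fun x hx y hy =>
  let ⟨z, _, hxz, hyz⟩ := hS x hx y hy
  ⟨z, hxz, hyz⟩

lemma pairwiseBounded_of_isUB {S : Set Coderivation} {z : Coderivation} (hz : IsUB S z) :
    PairwiseBounded S := fun x hx y hy => ⟨z, hz x hx, hz y hy⟩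

/-! ## The least and the maximal elements -/

lemma hypC_mem_dom (Γ : Sequent) : hypC Γ ∈ Dom Γ := by
  refine ⟨fun w r Δ hw => ?_, rfl⟩
  have hp : (hypC Γ).premsAt w = [] :=
    Coderivation.premsAt_eq_nil fun b => by cases w <;> rfl
  rw [hp]
  cases w with
  | nil =>
    cases hw
    exact ⟨Or.inl rfl, ruleOk_hyp Γ⟩
  | cons c w => cases hw

lemma hypC_approx {Γ : Sequent} {D : Coderivation} (hD : D ∈ Dom Γ) : Approx (hypC Γ) D := by
  refine (approx_iff_nodewiseLe (hypC_mem_dom Γ).1 hD.1).2 fun w r Δ hw => ?_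
  cases w with
  | nil =>
    cases hw
    obtain ⟨r', hr'⟩ := exists_label_nil hD.2
    exact ⟨r', hr', Or.inl rfl⟩
  | cons c w => cases hw

/-- Replace the rule at the node `v`, of sequent `Δ`, by a cut between two hypotheses. -/
def graftCutLabel (D : Coderivation) (v : Node) (Δ : Sequent) (w : Node) :
    Option (RuleName × Sequent) :=
  if w = v then some (.cut, Δ)
  else if w = v ++ [false] then some (.hyp, .one :: Δ)
  else if w = v ++ [true] then some (.hyp, [.bot])
  else D.label w

lemma graftCutLabel_isSome {D : Coderivation} {v w : Node} (Δ : Sequent)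
    (h : (D.label w).isSome) : (graftCutLabel D v Δ w).isSome := by
  unfold graftCutLabel
  split_ifs <;> first | rfl | exact h

def graftCut (D : Coderivation) (v : Node) (Δ : Sequent) (hv : D.mem v) : Coderivation where
  label := graftCutLabel D v Δ
  root_isSome := graftCutLabel_isSome Δ D.root_isSome
  prefix_closed w b h := by
    unfold graftCutLabel at h
    split_ifs at h with h₁ h₂ h₃
    · exact graftCutLabel_isSome Δ (D.prefix_closed w b (h₁ ▸ hv))
    · obtain rfl := List.append_inj_left' h₂ rfl
      exact graftCutLabel_isSome Δ hv
    · obtain rfl := List.append_inj_left' h₃ rfl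
      exact graftCutLabel_isSome Δ hv
    · exact graftCutLabel_isSome Δ (D.prefix_closed w b h)
  ordered w h := by
    unfold graftCutLabel at h
    split_ifs at h with h₁ h₂ h₃
    · exact graftCutLabel_isSome Δ (D.ordered w (h₁ ▸ hv))
    · simp at h₂
    · obtain rfl := List.append_inj_left' h₃ rfl
      simp [graftCutLabel]
    · exact graftCutLabel_isSome Δ (D.ordered w h)

lemma graftCut_isOver {D : Coderivation} (hD : OPLLinf D) {v : Node} {Δ : Sequent}
    (hv : D.label v = some (.hyp, Δ)) (hv' : D.mem v) : OPLLinf (graftCut D v Δ hv') := by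
  intro w r Θ hw
  by_cases h₁ : w = v
  · subst h₁
    obtain ⟨rfl, rfl⟩ : RuleName.cut = r ∧ Δ = Θ := by simpa [graftCut, graftCutLabel] using hw
    refine ⟨by simp [oPllInfRules, pllInfRules], ?_⟩
    have hp : (graftCut D w Δ hv').premsAt w = [.one :: Δ, [.bot]] := by
      simp [Coderivation.premsAt, Coderivation.seqAt, graftCut, graftCutLabel]
    rw [hp]
    exact ⟨Δ ++ [], _, .cut .one Δ [], by simp, .cons (.refl _) (.cons (.refl _) .nil)⟩
  by_cases h₂ : ∃ b, w = v ++ [b]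
  · obtain ⟨b, rfl⟩ := h₂
    have hp : (graftCut D v Δ hv').premsAt (v ++ [b]) = [] := by
      refine Coderivation.premsAt_eq_nil fun c => ?_
      have hn : D.label (v ++ [b] ++ [c]) = none :=
        hD.hyp_leaf hv (by simp) (by simp)
      simpa [graftCut, graftCutLabel] using hn
    rw [hp]
    obtain rfl : r = .hyp := by
      cases b
      · exact ((by simpa [graftCut, graftCutLabel] using hw : RuleName.hyp = r ∧ _).1).symm
      · exact ((by simpa [graftCut, graftCutLabel] using hw : RuleName.hyp = r ∧ _).1).symm
    exact ⟨Or.inl rfl, ruleOk_hyp Θ⟩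
  · push Not at h₂
    have hDw : D.label w = some (r, Θ) := by
      simpa [graftCut, graftCutLabel, h₁, h₂ false, h₂ true] using hw
    have hp : (graftCut D v Δ hv').premsAt w = D.premsAt w := by
      refine Coderivation.premsAt_congr fun b => ?_
      have e : ∀ c, w ++ [b] ≠ v ++ [c] := fun c he => h₁ (List.append_inj_left' he rfl)
      by_cases hb : w ++ [b] = v
      · simp [Coderivation.seqAt, graftCut, graftCutLabel, hb, hv]
      · simp only [Coderivation.seqAt, graftCut, graftCutLabel, if_neg hb, if_neg (e _)]
    rw [hp]
    exact hD w r Θ hDw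

lemma nodewiseLe_graftCut {D : Coderivation} (hD : OPLLinf D) {v : Node} {Δ : Sequent}
    (hv : D.label v = some (.hyp, Δ)) (hv' : D.mem v) : NodewiseLe D (graftCut D v Δ hv') := by
  intro w r Θ hw
  by_cases h₁ : w = v
  · subst h₁
    obtain ⟨rfl, rfl⟩ : RuleName.hyp = r ∧ Δ = Θ := by simpa [hv] using hw
    exact ⟨.cut, by simp [graftCut, graftCutLabel], Or.inl rfl⟩
  · have e : ∀ b, w ≠ v ++ [b] := by
      rintro b rfl
      have := hD.hyp_leaf hv (List.prefix_append v [b]) (by simp)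
      simp [hw] at this
    exact ⟨r, by simpa [graftCut, graftCutLabel, h₁, e] using hw, Or.inr rfl⟩

lemma maxOn_iff {Γ : Sequent} {D : Coderivation} (hD : D ∈ Dom Γ) : MaxOn Γ D ↔ PLLinf D := by
  constructor
  · intro hmax w r Δ hw
    obtain ⟨hr, hok⟩ := hD.1 w r Δ hw
    refine ⟨hr.resolve_left ?_, hok⟩
    rintro rfl
    have hmem : D.mem w := by simp [Coderivation.mem, hw]
    have hle := nodewiseLe_graftCut hD.1 hw hmem
    have hover := graftCut_isOver hD.1 hw hmem
    have hconcl : (graftCut D w Δ hmem).conclusion = Γ := by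
      obtain ⟨s, hs⟩ := exists_label_nil hD.2
      obtain ⟨s', hs', -⟩ := hle _ _ _ hs
      exact conclusion_eq_of_label hs'
    have heq := hmax _ ⟨hover, hconcl⟩ ((approx_iff_nodewiseLe hD.1 hover).2 hle)
    have : (graftCut D w Δ hmem).label w = some (.cut, Δ) := by simp [graftCut, graftCutLabel]
    rw [← heq, hw] at this
    simp at this
  · intro hP y hy hle
    have hne : ∀ w Δ, D.label w ≠ some (.hyp, Δ) := fun w Δ hw => by
      simpa [pllInfRules] using (hP w _ Δ hw).1
    refine Coderivation.eq_of_label fun w => ?_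
    rcases hw : D.label w with _ | ⟨r, Δ⟩
    · by_contra hyw
      obtain ⟨v, Δ, -, -, hv⟩ := hle.nodewiseLe.exists_hyp_below hP hy.1
        (Option.isSome_iff_ne_none.2 (Ne.symm hyw)) hw
      exact hne v Δ hv
    · obtain ⟨r', hr', rfl | rfl⟩ := hle.nodewiseLe w r Δ hw
      · exact absurd hw (hne w Δ)
      · exact hr'.symm

/-! ## Finite approximations -/

lemma prune_isOver {D : Coderivation} (hD : OPLLinf D) (V : Set Node) : OPLLinf (prune D V) := by
  intro w r Δ hw
  change pruneLabel D V w = _ at hw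
  obtain ⟨-, hV⟩ := pruneLabel_isSome (hw ▸ rfl : (pruneLabel D V w).isSome)
  by_cases hwV : w ∈ V
  · obtain rfl : r = .hyp := by
      rw [pruneLabel_of_mem hV hwV, Option.map_eq_some_iff] at hw
      obtain ⟨p, -, he⟩ := hw
      exact (congrArg Prod.fst he).symm
    have hp : (prune D V).premsAt w = [] := Coderivation.premsAt_eq_nil fun b =>
      pruneLabel_of_below ⟨w, hwV, List.prefix_append _ _, by simp⟩
    rw [hp]
    exact ⟨Or.inl rfl, ruleOk_hyp Δ⟩
  · rw [pruneLabel_of_notMem hV hwV] at hw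
    have hp : (prune D V).premsAt w = D.premsAt w := by
      refine Coderivation.premsAt_congr fun b => ?_
      have hVb : ¬ ∃ v ∈ V, v <+: w ++ [b] ∧ v ≠ w ++ [b] := by
        rintro ⟨v, hv, hpre, hne⟩
        have hvw := (prefix_snoc_cases hpre).resolve_right hne
        exact hV ⟨v, hv, hvw, fun he => hwV (he ▸ hv)⟩
      change (pruneLabel D V (w ++ [b])).map _ = (D.label (w ++ [b])).map _
      by_cases hb : w ++ [b] ∈ V
      · rw [pruneLabel_of_mem hVb hb, Option.map_map]
        rfl
      · rw [pruneLabel_of_notMem hVb hb]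
    rw [hp]
    exact hD w r Δ hw

/-- The truncation of `D` at height `n`. -/
noncomputable def trunc (D : Coderivation) (n : ℕ) : Coderivation :=
  prune D {v | v.length = n}

lemma trunc_label {D : Coderivation} {n : ℕ} {w : Node} (h : w.length < n) :
    (trunc D n).label w = D.label w := by
  refine pruneLabel_of_notMem ?_ h.ne
  rintro ⟨v, hv, hvw, -⟩
  have := hvw.length_le
  simp only [Set.mem_ofPred_eq] at hv
  omega

lemma trunc_isFinite (D : Coderivation) (n : ℕ) : (trunc D n).IsFinite := by
  refine (List.finite_length_le Bool n).subset fun w hw => ?_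
  obtain ⟨-, hno⟩ := pruneLabel_isSome hw
  by_contra hlt
  simp only [Set.mem_ofPred_eq, not_le] at hlt
  refine hno ⟨w.take n, by simp [hlt.le], List.take_prefix n w, fun he => ?_⟩
  have := congrArg List.length he
  simp at this
  omega

lemma trunc_mem_dom {Γ : Sequent} {D : Coderivation} (hD : D ∈ Dom Γ) (n : ℕ) :
    trunc D (n + 1) ∈ Dom Γ := by
  refine ⟨prune_isOver hD.1 _, ?_⟩
  rw [Coderivation.conclusion, trunc_label (by simp)]
  exact hD.2

lemma finiteApprox_nonempty {Γ : Sequent} {D : Coderivation} (hD : D ∈ Dom Γ) :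
    {E | E ∈ Dom Γ ∧ E.IsFinite ∧ Approx E D}.Nonempty :=
  ⟨trunc D 1, trunc_mem_dom hD 0, trunc_isFinite D 1, approx_prune D _⟩

lemma directedOn_finiteApprox (Γ : Sequent) (D : Coderivation) (hD : D ∈ Dom Γ) :
    DirectedOn Approx {E | E ∈ Dom Γ ∧ E.IsFinite ∧ Approx E D} := by
  rintro x ⟨hx, hxf, hxD⟩ y ⟨hy, hyf, hyD⟩
  have hne : ({x, y} : Set Coderivation).Nonempty := ⟨x, by simp⟩
  have hub : IsUB {x, y} D := by
    rintro z (rfl | rfl)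
    · exact hxD
    · exact hyD
  have hsub : {x, y} ⊆ Dom Γ := by
    rintro z (rfl | rfl)
    · exact hx
    · exact hy
  have hlub := (pairwiseBounded_of_isUB hub).isLubOn_supOf hne hsub
  refine ⟨supOf {x, y} hne, ⟨hlub.1, ?_, hlub.2.2 D hD hub⟩, hlub.2.1 x (by simp),
    hlub.2.1 y (by simp)⟩
  refine (hxf.union hyf).subset fun w hw => ?_
  obtain ⟨p, hp⟩ := Option.isSome_iff_exists.1 hw
  obtain ⟨z, rfl | rfl, hz⟩ := exists_of_supLabel hp
  · exact Or.inl (by simp [Coderivation.mem, hz])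
  · exact Or.inr (by simp [Coderivation.mem, hz])

lemma isLubOn_finiteApprox {Γ : Sequent} {D : Coderivation} (hD : D ∈ Dom Γ) :
    IsLubOn Γ {E | E ∈ Dom Γ ∧ E.IsFinite ∧ Approx E D} D := by
  refine ⟨hD, fun E hE => hE.2.2, fun z hz hub => ?_⟩
  refine (approx_iff_nodewiseLe hD.1 hz.1).2 fun w r Δ hw => ?_
  have hT := hub (trunc D (w.length + 1))
    ⟨trunc_mem_dom hD _, trunc_isFinite D _, approx_prune D _⟩
  exact hT.nodewiseLe w r Δ ((trunc_label (Nat.lt_succ_self _)).trans hw)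

lemma exists_mem_forall_of_directedOn {S : Set Coderivation} (hne : S.Nonempty)
    (hS : DirectedOn Approx S) {P : Coderivation → Node → Prop}
    (hmono : ∀ x y w, Approx x y → P x w → P y w) {T : Set Node} (hT : T.Finite)
    (h : ∀ w ∈ T, ∃ x ∈ S, P x w) : ∃ y ∈ S, ∀ w ∈ T, P y w := by
  induction T, hT using Set.Finite.induction_on with
  | empty => exact ⟨hne.some, hne.some_mem, by simp⟩
  | insert _ _ ih =>
    obtain ⟨y, hy, hyP⟩ := ih fun w hw => h w (Or.inr hw)
    obtain ⟨x, hx, hxP⟩ := h _ (Set.mem_insert _ _)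
    obtain ⟨z, hz, hyz, hxz⟩ := hS y hy x hx
    refine ⟨z, hz, ?_⟩
    rintro w (rfl | hw)
    · exact hmono x z w hxz hxP
    · exact hmono y z w hyz (hyP w hw)

lemma compactOn_iff {Γ : Sequent} {D : Coderivation} (hD : D ∈ Dom Γ) :
    CompactOn Γ D ↔ D.IsFinite := by
  constructor
  · intro hc
    obtain ⟨E, ⟨-, hEf, -⟩, hDE⟩ := hc _ (fun E hE => hE.1) (finiteApprox_nonempty hD)
      (directedOn_finiteApprox Γ D hD) D (isLubOn_finiteApprox hD) (approx_refl D)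
    refine hEf.subset fun w hw => ?_
    obtain ⟨⟨r, Δ⟩, hp⟩ := Option.isSome_iff_exists.1 hw
    obtain ⟨r', hr', -⟩ := hDE.nodewiseLe w r Δ hp
    simp [Coderivation.mem, hr']
  · intro hfin S hΓ hne hdir u hu hDu
    have hlub := (pairwiseBounded_of_directedOn hdir).isLubOn_supOf hne hΓ
    have hDs := approx_trans hDu (hu.2.2 _ hlub.1 hlub.2.1)
    let P : Coderivation → Node → Prop := fun x w => ∀ r Δ, D.label w = some (r, Δ) →
      ∃ r', x.label w = some (r', Δ) ∧ (r = .hyp ∨ r' = r)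
    have hmono : ∀ x y w, Approx x y → P x w → P y w := by
      intro x y w hxy hx r Δ hw
      obtain ⟨r', hr', h⟩ := hx r Δ hw
      obtain ⟨r'', hr'', h'⟩ := hxy.nodewiseLe w r' Δ hr'
      refine ⟨r'', hr'', ?_⟩
      rcases h with h | rfl
      · exact Or.inl h
      · exact h'
    have hex : ∀ w ∈ {w | D.mem w}, ∃ x ∈ S, P x w := by
      intro w hw
      obtain ⟨⟨r, Δ⟩, hp⟩ := Option.isSome_iff_exists.1 hw
      obtain ⟨r', hr', h⟩ := hDs.nodewiseLe w r Δ hp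
      obtain ⟨x, hx, hxw⟩ := exists_of_supLabel hr'
      refine ⟨x, hx, fun s Θ hs => ?_⟩
      obtain ⟨rfl, rfl⟩ : r = s ∧ Δ = Θ := by simpa [hp] using hs
      exact ⟨r', hxw, h⟩
    obtain ⟨y, hy, hyP⟩ := exists_mem_forall_of_directedOn hne hdir hmono hfin hex
    refine ⟨y, hy, (approx_iff_nodewiseLe hD.1 (hΓ hy).1).2 fun w r Δ hw => ?_⟩
    exact hyP w (by simp [Coderivation.mem, hw]) r Δ hw

/-- **Proposition 5.4**: for every sequent `Γ`, the open coderivations with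
conclusion `Γ`, ordered by approximation, form a Scott domain: a partial order
which is directed-complete and bounded-complete, with least element the open
derivation `hyp`, whose maximal elements are exactly the (hyp-free)
coderivations of `PLL∞`, whose compact elements are exactly the (finite) open
derivations, and which is algebraic. -/
theorem open_coderivations_scott_domain (Γ : Sequent) :
    (∀ D : Coderivation, Approx D D) ∧
    (∀ D E F : Coderivation, Approx D E → Approx E F → Approx D F) ∧
    (∀ D E, D ∈ Dom Γ → E ∈ Dom Γ → Approx D E → Approx E D → D = E) ∧
    (hypC Γ ∈ Dom Γ ∧ ∀ D ∈ Dom Γ, Approx (hypC Γ) D) ∧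
    (∀ S ⊆ Dom Γ, S.Nonempty → DirectedOn Approx S → ∃ u, IsLubOn Γ S u) ∧
    (∀ S ⊆ Dom Γ, S.Nonempty → (∃ w ∈ Dom Γ, IsUB S w) → ∃ u, IsLubOn Γ S u) ∧
    (∀ D ∈ Dom Γ, (MaxOn Γ D ↔ PLLinf D)) ∧
    (∀ D ∈ Dom Γ, (CompactOn Γ D ↔ D.IsFinite)) ∧
    (∀ D ∈ Dom Γ, DirectedOn Approx {E | E ∈ Dom Γ ∧ E.IsFinite ∧ Approx E D} ∧
      IsLubOn Γ {E | E ∈ Dom Γ ∧ E.IsFinite ∧ Approx E D} D) := by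
  refine ⟨approx_refl, fun _ _ _ => approx_trans, fun _ _ _ _ => approx_antisymm,
    ⟨hypC_mem_dom Γ, fun _ => hypC_approx⟩, fun S hΓ hne hdir => ?_, fun S hΓ hne hbdd => ?_,
    fun _ => maxOn_iff, fun _ => compactOn_iff,
    fun D hD => ⟨directedOn_finiteApprox Γ D hD, isLubOn_finiteApprox hD⟩⟩
  · exact ⟨_, (pairwiseBounded_of_directedOn hdir).isLubOn_supOf hne hΓ⟩
  · obtain ⟨w, -, hw⟩ := hbdd
    exact ⟨_, (pairwiseBounded_of_isUB hw).isLubOn_supOf hne hΓ⟩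

end NWPLL
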